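/- For all positive integers n, r, s: Z_{n+r}·W_{n+s} − Z_n·W_{n+r+s} = (−q)^n·u_r·(q·u_{s−1}·(Z_1·W_0 − Z_0·W_1) + u_s·(Z_1·W_1 − p·Z_0·W_1 − q·Z_0·W_0)). -/

import Mathlib

open Quaternion

theorem horadamQuaternion_add_two {R : Type*} [CommRing R] {p q : R} {w : ℕ → R}
    (hw : ∀ n, w (n + 2) = p * w (n + 1) + q * w n) {W : ℕ → ℍ[R]}
    (hW : ∀ n, W n = ⟨w n, w (n + 1), w (n + 2), w (n + 3)⟩) (n : ℕ) :
    W (n + 2) = p • W (n + 1) + q • W n := by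
  ext
  all_goals
    simp only [Quaternion.re_add, Quaternion.imI_add, Quaternion.imJ_add, Quaternion.imK_add,
      Quaternion.re_smul, Quaternion.imI_smul, Quaternion.imJ_smul, Quaternion.imK_smul,
      smul_eq_mul]
    rw [hW, hW, hW]
    exact hw _

/-- A second-order linear recurrence expressed through its fundamental solution `u`. -/
theorem horadam_add {R M : Type*} [CommRing R] [AddCommGroup M] [Module R M] {p q : R}
    {u : ℕ → R} (hu : ∀ n, u (n + 2) = p * u (n + 1) + q * u n) (hu0 : u 0 = 0) (hu1 : u 1 = 1)
    {X : ℕ → M} (hX : ∀ n, X (n + 2) = p • X (n + 1) + q • X n) (m k : ℕ) :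
    X (m + k + 1) = u (k + 1) • X (m + 1) + (q * u k) • X m := by
  induction k generalizing m with
  | zero => simp [hu0, hu1]
  | succ k ih =>
    rw [show m + (k + 1) + 1 = (m + 1) + k + 1 by ring, ih (m + 1), hX m, hu k]
    module

theorem horadam_mul_sub_mul {R A : Type*} [CommRing R] [Ring A] [Algebra R A] {p q : R}
    {Z W : ℕ → A} (hZ : ∀ n, Z (n + 2) = p • Z (n + 1) + q • Z n)
    (hW : ∀ n, W (n + 2) = p • W (n + 1) + q • W n) (n s : ℕ) :
    Z (n + 1) * W (n + s) - Z n * W (n + s + 1) =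
      (-q) ^ n • (Z 1 * W s - Z 0 * W (s + 1)) := by
  induction n with
  | zero => simp
  | succ n ih =>
    rw [pow_succ', mul_smul, ← ih, show n + 1 + s = n + s + 1 by ring, hZ n, hW (n + s)]
    simp only [add_mul, mul_add, smul_mul_assoc, mul_smul_comm]
    module

theorem stmt11 (p q : ℝ) (w : ℕ → ℝ) (hw : ∀ n, w (n + 2) = p * w (n + 1) + q * w n)
    (W : ℕ → ℍ[ℝ]) (hW : ∀ n, W n = ⟨w n, w (n + 1), w (n + 2), w (n + 3)⟩)
    (z : ℕ → ℝ) (hz : ∀ n, z (n + 2) = p * z (n + 1) + q * z n)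
    (Z : ℕ → ℍ[ℝ]) (hZ : ∀ n, Z n = ⟨z n, z (n + 1), z (n + 2), z (n + 3)⟩)
    (u : ℕ → ℝ) (hu : ∀ n, u (n + 2) = p * u (n + 1) + q * u n)
    (hu0 : u 0 = 0) (hu1 : u 1 = 1)
    (U : ℕ → ℍ[ℝ]) (hU : ∀ n, U n = ⟨u n, u (n + 1), u (n + 2), u (n + 3)⟩)
    (n r s : ℕ) (hn : 1 ≤ n) (hr : 1 ≤ r) (hs : 1 ≤ s) :
    Z (n + r) * W (n + s) - Z n * W (n + r + s) =
      ((-q) ^ n * u r) •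
        ((q * u (s - 1)) • (Z 1 * W 0 - Z 0 * W 1) +
          u s • (Z 1 * W 1 - p • (Z 0 * W 1) - q • (Z 0 * W 0))) := by
  have hW' : ∀ n, W (n + 2) = p • W (n + 1) + q • W n := horadamQuaternion_add_two hw hW
  have hZ' : ∀ n, Z (n + 2) = p • Z (n + 1) + q • Z n := horadamQuaternion_add_two hz hZ
  obtain ⟨r, rfl⟩ := Nat.exists_eq_add_of_le' hr
  obtain ⟨s, rfl⟩ := Nat.exists_eq_add_of_le' hs
  have hZr := horadam_add hu hu0 hu1 hZ' n r
  have hWr := horadam_add hu hu0 hu1 hW' (n + (s + 1)) r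
  have hWs := horadam_add hu hu0 hu1 hW' 0 s
  have hWs' := horadam_add hu hu0 hu1 hW' 1 s
  rw [show 0 + s + 1 = s + 1 by ring] at hWs
  rw [show 1 + s + 1 = s + 1 + 1 by ring, hW' 0] at hWs'
  have hD := horadam_mul_sub_mul hZ' hW' n (s + 1)
  rw [hWs, hWs'] at hD
  have hred : Z (n + (r + 1)) * W (n + (s + 1)) - Z n * W (n + (r + 1) + (s + 1)) =
      u (r + 1) • (Z (n + 1) * W (n + (s + 1)) - Z n * W (n + (s + 1) + 1)) := by
    rw [show n + (r + 1) + (s + 1) = n + (s + 1) + r + 1 by ring, ← add_assoc n r 1, hZr, hWr]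
    simp only [add_mul, mul_add, smul_mul_assoc, mul_smul_comm]
    module
  rw [hred, hD, Nat.add_sub_cancel]
  simp only [mul_add, mul_smul_comm, zero_add]
  module
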